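/- Double selector failure, probability that an SF row is an SP row when the intersection entry is 1: let μ be the product Bernoulli(q) measure on Fin N → Fin N → Bool, 0 < q < 1. Fix φ = {(i,j),(i',j')} with i ≠ i', j ≠ j'. Then the conditional probability, given the event {X i j = true ∧ X i' j' = true ∧ X i j' = true}, that row i contains an SP cell equals 1 − (q + (1−q)²)^{N−2}; the same holds for column j'. -/

import Mathlib

open MeasureTheory

/-- Bernoulli(q) measure on `Bool`: `true` has probability `q`. -/
noncomputable def bern (q : ℝ) : Measure Bool :=
  (ENNReal.ofReal q) • Measure.dirac true + (ENNReal.ofReal (1 - q)) • Measure.dirac false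

instance (q : ℝ) : IsFiniteMeasure (bern q) := by
  constructor
  simp [bern, Measure.add_apply, Measure.smul_apply]

/-- Product measure on `Fin N → Fin N → Bool` making the `N²` entries i.i.d. Bernoulli(q). -/
noncomputable def arrMeasure (N : ℕ) (q : ℝ) : Measure (Fin N → Fin N → Bool) :=
  Measure.pi fun _ => Measure.pi fun _ => bern q

/-- Cell `(m,n)` is an SP cell for the double-SF set `{(i,j),(i',j')}` (both active). -/
def IsSPCellDouble (N : ℕ) (X : Fin N → Fin N → Bool)
    (i i' j j' m n : Fin N) : Prop :=
  X m n = false ∧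
    ((X i n = true ∧ X m j = true) ∨ (X i' n = true ∧ X m j' = true))

theorem aux_prod (N : ℕ) (a b : Fin N) (hab : a ≠ b) (x y z : ENNReal) :
    ∏ k : Fin N, (if k = a then x else if k = b then y else z) = x * y * z ^ (N - 2) := by
  have hb : b ∈ (Finset.univ.erase a : Finset (Fin N)) := by simp [hab.symm]
  rw [← Finset.mul_prod_erase Finset.univ _ (Finset.mem_univ a),
    ← Finset.mul_prod_erase _ _ hb]
  have hc : ∏ k ∈ (Finset.univ.erase a).erase b,
      (if k = a then x else if k = b then y else z) = z ^ (N - 2) := by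
    rw [Finset.prod_congr rfl (g := fun _ => z)]
    · rw [Finset.prod_const, Finset.card_erase_of_mem hb, Finset.card_erase_of_mem (Finset.mem_univ a)]
      simp [Nat.sub_sub]
    · intro k hk
      simp only [Finset.mem_erase] at hk
      simp [hk.1, hk.2.1]
  rw [hc]
  simp [hab.symm, mul_assoc]

theorem aux_bern_true (q : ℝ) : bern q {true} = ENNReal.ofReal q := by
  simp [bern]

theorem aux_bern_false (q : ℝ) : bern q {false} = ENNReal.ofReal (1 - q) := by
  simp [bern]

theorem aux_bern_prob (q : ℝ) (hq0 : 0 < q) (hq1 : q < 1) : IsProbabilityMeasure (bern q) := by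
  constructor
  simp only [bern, Measure.add_apply, Measure.smul_apply, measure_univ, smul_eq_mul, mul_one]
  rw [← ENNReal.ofReal_add hq0.le (by linarith)]
  simp

theorem aux_row2 (N : ℕ) (q : ℝ) (hq0 : 0 < q) (hq1 : q < 1) (a b : Fin N) (hab : a ≠ b)
    (S T : Set Bool) :
    (Measure.pi fun _ : Fin N => bern q) {r | r a ∈ S ∧ r b ∈ T} = bern q S * bern q T := by
  have := aux_bern_prob q hq0 hq1
  have h : {r : Fin N → Bool | r a ∈ S ∧ r b ∈ T} =
      Set.univ.pi (fun k => if k = a then S else if k = b then T else Set.univ) := by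
    ext r
    simp only [Set.mem_setOf_eq, Set.mem_pi, Set.mem_univ, true_imp_iff]
    constructor
    · rintro ⟨h1, h2⟩ k
      split_ifs with h h'
      · exact h ▸ h1
      · exact h' ▸ h2
      · trivial
    · intro h
      refine ⟨by simpa using h a, by simpa [hab.symm] using h b⟩
  rw [h, Measure.pi_pi]
  have : ∀ k, bern q (if k = a then S else if k = b then T else Set.univ) =
      if k = a then bern q S else if k = b then bern q T else 1 := by
    intro k
    split_ifs
    · rfl
    · rfl
    · exact measure_univ
  rw [Finset.prod_congr rfl (fun k _ => this k), aux_prod N a b hab]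
  simp

theorem aux_rows (N : ℕ) (q : ℝ) (a a' : Fin N) (haa : a ≠ a')
    (S T U : Set (Fin N → Bool)) :
    arrMeasure N q {X | X a ∈ S ∧ X a' ∈ T ∧ ∀ m, m ≠ a → m ≠ a' → X m ∈ U} =
      (Measure.pi fun _ : Fin N => bern q) S * (Measure.pi fun _ : Fin N => bern q) T *
      (Measure.pi fun _ : Fin N => bern q) U ^ (N - 2) := by
  have h : {X : Fin N → Fin N → Bool | X a ∈ S ∧ X a' ∈ T ∧ ∀ m, m ≠ a → m ≠ a' → X m ∈ U} =
      Set.univ.pi (fun k => if k = a then S else if k = a' then T else U) := by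
    ext r
    simp only [Set.mem_setOf_eq, Set.mem_pi, Set.mem_univ, true_imp_iff]
    constructor
    · rintro ⟨h1, h2, h3⟩ k
      split_ifs with h h'
      · exact h ▸ h1
      · exact h' ▸ h2
      · exact h3 k h h'
    · intro h
      refine ⟨by simpa using h a, by simpa [haa.symm] using h a', fun m h1 h2 => ?_⟩
      simpa [h1, h2] using h m
  rw [h, arrMeasure, Measure.pi_pi, ← aux_prod N a a' haa]
  refine Finset.prod_congr rfl fun k _ => ?_
  split_ifs <;> rfl

theorem aux_main (N : ℕ) (q : ℝ) (hq0 : 0 < q) (hq1 : q < 1) (a a' b b' : Fin N)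
    (haa : a ≠ a') (hbb : b ≠ b') (A C : Set (Fin N → Fin N → Bool))
    (hC : ∀ X, X ∈ C ↔ X a b = true ∧ X a b' = true ∧ X a' b' = true)
    (hA : ∀ X, X ∈ C → (X ∈ A ↔ ∃ m, X m b' = false ∧ X m b = true)) :
    arrMeasure N q (A ∩ C) / arrMeasure N q C =
      ENNReal.ofReal (1 - (q + (1 - q) ^ 2) ^ (N - 2)) := by
  have := aux_bern_prob q hq0 hq1
  set ν := (Measure.pi fun _ : Fin N => bern q) with hν
  set S : Set (Fin N → Bool) := {r | r b ∈ ({true} : Set Bool) ∧ r b' ∈ ({true} : Set Bool)} with hS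
  set T : Set (Fin N → Bool) := {r | r b ∈ (Set.univ : Set Bool) ∧ r b' ∈ ({true} : Set Bool)} with hT
  set V : Set (Fin N → Bool) := {r | r b ∈ ({true} : Set Bool) ∧ r b' ∈ ({false} : Set Bool)} with hV
  have eS : ν S = ENNReal.ofReal (q * q) := by
    rw [hS, hν, aux_row2 N q hq0 hq1 b b' hbb, aux_bern_true, ← ENNReal.ofReal_mul hq0.le]
  have eT : ν T = ENNReal.ofReal q := by
    rw [hT, hν, aux_row2 N q hq0 hq1 b b' hbb, aux_bern_true, measure_univ, one_mul]
  have eV : ν Vᶜ = ENNReal.ofReal (q + (1 - q) ^ 2) := by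
    rw [prob_compl_eq_one_sub (Set.toFinite V).measurableSet, hV, hν,
      aux_row2 N q hq0 hq1 b b' hbb, aux_bern_true, aux_bern_false, ← ENNReal.ofReal_mul hq0.le,
      ← ENNReal.ofReal_one, ← ENNReal.ofReal_sub _ (by nlinarith)]
    congr 1
    ring
  have eC : arrMeasure N q C = ENNReal.ofReal (q * q * q) := by
    have h : C = {X | X a ∈ S ∧ X a' ∈ T ∧ ∀ m, m ≠ a → m ≠ a' → X m ∈ Set.univ} := by
      ext X
      rw [hC]
      simp [hS, hT, and_assoc]
    rw [h, aux_rows N q a a' haa, ← hν, eS, eT, measure_univ, one_pow, mul_one,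
      ← ENNReal.ofReal_mul (by positivity)]
  have eD : arrMeasure N q (C \ A) =
      ENNReal.ofReal (q * q * q * (q + (1 - q) ^ 2) ^ (N - 2)) := by
    have h : C \ A = {X | X a ∈ S ∧ X a' ∈ T ∧ ∀ m, m ≠ a → m ≠ a' → X m ∈ Vᶜ} := by
      ext X
      simp only [Set.mem_diff, Set.mem_setOf_eq, hS, hT, hV, Set.mem_compl_iff,
        Set.mem_singleton_iff, Set.mem_univ, true_and]
      constructor
      · rintro ⟨h1, h2⟩
        rw [hA X h1] at h2
        rw [hC] at h1
        exact ⟨⟨h1.1, h1.2.1⟩, h1.2.2, fun m _ _ h => h2 ⟨m, h.2, h.1⟩⟩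
      · rintro ⟨⟨h1, h2⟩, h3, h4⟩
        have hc : X ∈ C := (hC X).2 ⟨h1, h2, h3⟩
        refine ⟨hc, ?_⟩
        rw [hA X hc]
        rintro ⟨m, h5, h6⟩
        refine h4 m ?_ ?_ ⟨h6, h5⟩
        · rintro rfl
          simp [h2] at h5
        · rintro rfl
          simp [h3] at h5
    rw [h, aux_rows N q a a' haa, ← hν, eS, eT, eV, ← ENNReal.ofReal_mul (by positivity),
      ← ENNReal.ofReal_pow (by positivity), ← ENNReal.ofReal_mul (by positivity)]
  have hI : A ∩ C = C \ (C \ A) := by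
    ext X
    simp only [Set.mem_inter_iff, Set.mem_diff]
    tauto
  rw [hI, measure_diff Set.diff_subset (Set.toFinite _).measurableSet.nullMeasurableSet
    (by rw [eD]; exact ENNReal.ofReal_ne_top), eC, eD, ← ENNReal.ofReal_sub _ (by positivity),
    ← ENNReal.ofReal_div_of_pos (by positivity)]
  congr 1
  field_simp

theorem aux_swap (N : ℕ) (q : ℝ) (S : Set (Fin N → Fin N → Bool)) :
    arrMeasure N q S = arrMeasure N q {Y | (fun m n => Y n m) ∈ S} := by
  have h : Measure.map (fun (Y : Fin N → Fin N → Bool) => fun m n => Y n m) (arrMeasure N q)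
      = arrMeasure N q := by
    apply Measure.ext_of_singleton
    intro X
    rw [Measure.map_apply (by fun_prop) (Set.toFinite _).measurableSet]
    have : (fun (Y : Fin N → Fin N → Bool) => fun m n => Y n m) ⁻¹' {X} =
        {fun m n => X n m} := by
      ext Y
      simp only [Set.mem_preimage, Set.mem_singleton_iff]
      constructor
      · rintro rfl
        rfl
      · rintro rfl
        rfl
    rw [this]
    simp only [arrMeasure, Measure.pi_singleton]
    exact Finset.prod_comm
  conv_lhs => rw [← h]
  rw [Measure.map_apply (by fun_prop) (Set.toFinite _).measurableSet]
  rfl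

/-- Double selector failure: conditioned on both SFs being active and
the intersection entry `X i j' = true`, the probability that SF row `i` contains an
SP cell equals `1 − (q + (1−q)²)^{N−2}`; the same holds for SF column `j'`. -/
theorem double_sf_sf_row_is_sp_row_prob_of_intersection_one
    (N : ℕ) (hN : 2 ≤ N) (q : ℝ) (hq0 : 0 < q) (hq1 : q < 1)
    (i i' j j' : Fin N)
    (hii : i ≠ i') (hjj : j ≠ j') :
    ((arrMeasure N q) ({X : Fin N → Fin N → Bool |
          ∃ n : Fin N, IsSPCellDouble N X i i' j j' i n} ∩
        {X : Fin N → Fin N → Bool |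
          X i j = true ∧ X i' j' = true ∧ X i j' = true})
        / (arrMeasure N q) {X : Fin N → Fin N → Bool |
          X i j = true ∧ X i' j' = true ∧ X i j' = true}
      = ENNReal.ofReal (1 - (q + (1 - q) ^ 2) ^ (N - 2))) ∧
    ((arrMeasure N q) ({X : Fin N → Fin N → Bool |
          ∃ m : Fin N, IsSPCellDouble N X i i' j j' m j'} ∩
        {X : Fin N → Fin N → Bool |
          X i j = true ∧ X i' j' = true ∧ X i j' = true})
        / (arrMeasure N q) {X : Fin N → Fin N → Bool |
          X i j = true ∧ X i' j' = true ∧ X i j' = true}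
      = ENNReal.ofReal (1 - (q + (1 - q) ^ 2) ^ (N - 2))) := by
  constructor
  · rw [aux_swap N q ({X | ∃ n : Fin N, IsSPCellDouble N X i i' j j' i n} ∩ _),
      aux_swap N q {X | X i j = true ∧ X i' j' = true ∧ X i j' = true}]
    refine aux_main N q hq0 hq1 j' j i' i hjj.symm hii.symm
      {Y | ∃ n : Fin N, IsSPCellDouble N (fun m n => Y n m) i i' j j' i n}
      {Y | Y j i = true ∧ Y j' i' = true ∧ Y j' i = true} ?_ ?_
    · intro X
      simp only [Set.mem_setOf_eq]
      tauto
    · rintro X ⟨h1, h2, h3⟩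
      simp only [Set.mem_setOf_eq, IsSPCellDouble, h1, h3]
      refine exists_congr fun n => ?_
      cases X n i <;> simp
  · refine aux_main N q hq0 hq1 i i' j j' hii hjj _ _ ?_ ?_
    · intro X
      simp only [Set.mem_setOf_eq]
      tauto
    · rintro X ⟨h1, h2, h3⟩
      simp only [Set.mem_setOf_eq, IsSPCellDouble, h2, h3]
      refine exists_congr fun n => ?_
      cases X n j' <;> simp
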